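/- arXiv:1906.04282 — 3 statements merged into one kernel-verified Lean document; each statement's English description precedes it below -/
import Mathlib

section
/- (Catoni PAC-Bayes bound) Let l be the zero-one loss (so l takes values in {0,1}). For any δ > 0, any data distribution 𝒟 on the sample space X × Y, any prior probability distribution p on the measurable parameter space of Θ, and any fixed β > 1/2, with probability at least 1 − δ over the choice of an i.i.d. training set D ∼ 𝒟^m of size m, simultaneously for all probability distributions q on the parameter space: L[q] ≤ (1/(1 − 1/(2β))) · ( L̂[q] + (β/m)·( KL(q ‖ p) + log(1/δ) ) ). -/
open MeasureTheory ProbabilityTheory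
open scoped ENNReal

open Classical in
/-- Kullback-Leibler divergence between two measures, `∞` if `q` is not absolutely
continuous with respect to `p` or the log-likelihood ratio is not integrable. -/
noncomputable def klDiv' {Ω : Type*} [MeasurableSpace Ω] (q p : Measure Ω) : ℝ≥0∞ :=
  if q ≪ p ∧ Integrable (llr q p) q then ENNReal.ofReal (∫ ω, llr q p ω ∂q) else ⊤

lemma exp_neg_le_quad {t : ℝ} (ht : 0 ≤ t) : Real.exp (-t) ≤ 1 - t + t ^ 2 / 2 := by
  have h1 := Real.quadratic_le_exp_of_nonneg ht
  have h2 : 0 < 1 + t + t ^ 2 / 2 := by positivity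
  rw [Real.exp_neg]
  calc (Real.exp t)⁻¹ ≤ (1 + t + t ^ 2 / 2)⁻¹ := by gcongr
    _ ≤ 1 - t + t ^ 2 / 2 := by
      rw [inv_le_iff_one_le_mul₀ h2]
      nlinarith [sq_nonneg (t ^ 2)]

/-- Donsker-Varadhan inequality. -/
lemma dv_ineq {Θ : Type*} [MeasurableSpace Θ] (p q : Measure Θ) [IsProbabilityMeasure p]
    [IsProbabilityMeasure q] (g : Θ → ℝ) (hqp : q ≪ p) (hint : Integrable (llr q p) q)
    (hg : Integrable g q) (hge : Integrable (fun θ => Real.exp (g θ)) p) :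
    ∫ θ, g θ ∂q ≤ ∫ θ, llr q p θ ∂q + Real.log (∫ θ, Real.exp (g θ) ∂p) := by
  have h1 := integral_llr_tilted_right hqp hg hge hint
  have hP : IsProbabilityMeasure (p.tilted g) := isProbabilityMeasure_tilted hge
  have h2 := InformationTheory.integral_llr_add_sub_measure_univ_nonneg
    (hqp.trans (absolutelyContinuous_tilted hge)) (integrable_llr_tilted_right hqp hg hint hge)
  simp only [probReal_univ] at h2
  linarith

lemma single_mgf {Z : Type*} [MeasurableSpace Z] (μ : Measure Z) [IsProbabilityMeasure μ]
    (h : Z → ℝ) (h01 : ∀ z, h z = 0 ∨ h z = 1) (hm : Measurable h) {t : ℝ} (ht : 0 ≤ t) :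
    ∫ z, Real.exp ((t - t ^ 2 / 2) * (∫ z, h z ∂μ) - t * h z) ∂μ ≤ 1 := by
  have hi : Integrable h μ := by
    refine Integrable.of_bound hm.aestronglyMeasurable 1 (Filter.Eventually.of_forall fun z => ?_)
    rcases h01 z with h | h <;> simp [h]
  set r := ∫ z, h z ∂μ with hr
  have hr0 : 0 ≤ r := integral_nonneg fun z => by rcases h01 z with h | h <;> simp [h]
  have e : ∀ z, Real.exp ((t - t ^ 2 / 2) * r - t * h z)
      = Real.exp ((t - t ^ 2 / 2) * r) * (1 - (1 - Real.exp (-t)) * h z) := by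
    intro z
    rw [sub_eq_add_neg, Real.exp_add]
    rcases h01 z with h | h <;> simp [h]
  simp_rw [e]
  rw [integral_const_mul, integral_sub (integrable_const _) (hi.const_mul _), integral_const_mul,
    ← hr]
  simp only [integral_const, probReal_univ, smul_eq_mul, one_mul]
  have h1 := exp_neg_le_quad ht
  calc Real.exp ((t - t ^ 2 / 2) * r) * (1 - (1 - Real.exp (-t)) * r)
      ≤ Real.exp ((t - t ^ 2 / 2) * r) * Real.exp (-((t - t ^ 2 / 2) * r)) := by
        gcongr
        have := Real.add_one_le_exp (-((t - t ^ 2 / 2) * r))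
        nlinarith
    _ = 1 := by rw [← Real.exp_add]; simp

/-- The exponent. -/
noncomputable def expo {Θ Z : Type*} [MeasurableSpace Z] (μ : Measure Z) (h : Θ → Z → ℝ) (t : ℝ)
    {m : ℕ} (θ : Θ) (D : Fin m → Z) : ℝ :=
  ∑ i, ((t - t ^ 2 / 2) * (∫ z, h θ z ∂μ) - t * h θ (D i))

lemma measurable_risk {Θ Z : Type*} [MeasurableSpace Θ] [MeasurableSpace Z] (μ : Measure Z)
    [IsProbabilityMeasure μ] (h : Θ → Z → ℝ)
    (hm : Measurable (fun a : Θ × Z => h a.1 a.2)) : Measurable (fun θ => ∫ z, h θ z ∂μ) :=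
  (hm.stronglyMeasurable.integral_prod_right (ν := μ)).measurable

lemma measurable_expo {Θ Z : Type*} [MeasurableSpace Θ] [MeasurableSpace Z] (μ : Measure Z)
    [IsProbabilityMeasure μ] (h : Θ → Z → ℝ)
    (hm : Measurable (fun a : Θ × Z => h a.1 a.2)) {t : ℝ} (m : ℕ) : Measurable (fun a : Θ × (Fin m → Z) => expo μ h t a.1 a.2) := by
  unfold expo
  refine Finset.measurable_sum _ fun i _ => ?_
  refine (((measurable_risk μ h hm).comp measurable_fst).const_mul _).sub (Measurable.const_mul ?_ _)
  exact hm.comp (measurable_fst.prodMk ((measurable_pi_apply i).comp measurable_snd))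

lemma abs_risk_le {Θ Z : Type*} [MeasurableSpace Z] (μ : Measure Z)
    [IsProbabilityMeasure μ] (h : Θ → Z → ℝ)
    (h01 : ∀ θ z, h θ z = 0 ∨ h θ z = 1) (θ : Θ) : |∫ z, h θ z ∂μ| ≤ 1 := by
  have := norm_integral_le_of_norm_le_const (μ := μ) (f := h θ) (C := 1)
    (Filter.Eventually.of_forall fun z => by rcases h01 θ z with h | h <;> simp [h])
  simpa using this

lemma abs_expo_le {Θ Z : Type*} [MeasurableSpace Z] (μ : Measure Z)
    [IsProbabilityMeasure μ] (h : Θ → Z → ℝ)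
    (h01 : ∀ θ z, h θ z = 0 ∨ h θ z = 1) {t : ℝ} (m : ℕ) (θ : Θ) (D : Fin m → Z) :
    |expo μ h t θ D| ≤ m * (|t - t ^ 2 / 2| + |t|) := by
  unfold expo
  refine (Finset.abs_sum_le_sum_abs _ _).trans ?_
  have : ∀ i ∈ Finset.univ, |(t - t ^ 2 / 2) * (∫ z, h θ z ∂μ) - t * h θ (D i)|
      ≤ |t - t ^ 2 / 2| + |t| := by
    intro i _
    refine (abs_sub _ _).trans ?_
    rw [abs_mul, abs_mul]
    have h1 := abs_risk_le μ h h01 θ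
    have h2 : |h θ (D i)| ≤ 1 := by rcases h01 θ (D i) with h | h <;> simp [h]
    exact add_le_add (mul_le_of_le_one_right (abs_nonneg _) h1)
      (mul_le_of_le_one_right (abs_nonneg _) h2)
  refine (Finset.sum_le_sum this).trans ?_
  simp [mul_add]

lemma integrable_exp_expo {Θ Z : Type*} [MeasurableSpace Θ] [MeasurableSpace Z] (μ : Measure Z)
    [IsProbabilityMeasure μ] (h : Θ → Z → ℝ)
    (h01 : ∀ θ z, h θ z = 0 ∨ h θ z = 1) (hm : Measurable (fun a : Θ × Z => h a.1 a.2)) {t : ℝ} (m : ℕ) (ν : Measure (Θ × (Fin m → Z))) [IsFiniteMeasure ν] :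
    Integrable (fun a => Real.exp (expo μ h t a.1 a.2)) ν := by
  refine Integrable.of_bound (measurable_expo μ h hm m).exp.aestronglyMeasurable
    (Real.exp (m * (|t - t ^ 2 / 2| + |t|))) (Filter.Eventually.of_forall fun a => ?_)
  rw [Real.norm_eq_abs, Real.abs_exp]
  exact Real.exp_le_exp.2 ((le_abs_self _).trans (abs_expo_le μ h h01 m _ _))

lemma total_mgf {Θ Z : Type*} [MeasurableSpace Θ] [MeasurableSpace Z] (μ : Measure Z)
    [IsProbabilityMeasure μ] (h : Θ → Z → ℝ)
    (h01 : ∀ θ z, h θ z = 0 ∨ h θ z = 1) (hm : Measurable (fun a : Θ × Z => h a.1 a.2)) {t : ℝ} (ht : 0 ≤ t) (m : ℕ) (p : Measure Θ) [IsProbabilityMeasure p] :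
    ∫ D : Fin m → Z, ∫ θ, Real.exp (expo μ h t θ D) ∂p ∂(Measure.pi fun _ => μ) ≤ 1 := by
  rw [← integral_integral_swap (integrable_exp_expo μ h h01 hm m _)]
  have : ∀ θ, ∫ D : Fin m → Z, Real.exp (expo μ h t θ D) ∂(Measure.pi fun _ => μ) ≤ 1 := by
    intro θ
    unfold expo
    simp_rw [Real.exp_sum]
    rw [integral_fintype_prod_eq_pow
      (fun z => Real.exp ((t - t ^ 2 / 2) * (∫ z, h θ z ∂μ) - t * h θ z))]
    exact pow_le_one₀ (integral_nonneg fun _ => (Real.exp_pos _).le)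
      (single_mgf μ (h θ) (h01 θ) (hm.comp measurable_prodMk_left) ht)
  calc _ ≤ ∫ θ, (1 : ℝ) ∂p :=
        integral_mono_of_nonneg
          (Filter.Eventually.of_forall fun _ => integral_nonneg fun _ => (Real.exp_pos _).le)
          (integrable_const _) (Filter.Eventually.of_forall this)
    _ = 1 := by simp

lemma markov_step {Θ Z : Type*} [MeasurableSpace Θ] [MeasurableSpace Z] (μ : Measure Z)
    [IsProbabilityMeasure μ] (h : Θ → Z → ℝ)
    (h01 : ∀ θ z, h θ z = 0 ∨ h θ z = 1) (hm : Measurable (fun a : Θ × Z => h a.1 a.2)) {t : ℝ} (ht : 0 ≤ t) (m : ℕ) (p : Measure Θ) [IsProbabilityMeasure p] (δ : ℝ) (hδ : 0 < δ) :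
    ENNReal.ofReal (1 - δ) ≤ (Measure.pi fun _ : Fin m => μ)
      {D | ∫ θ, Real.exp (expo μ h t θ D) ∂p ≤ 1 / δ} := by
  set P := (Measure.pi fun _ : Fin m => μ)
  have hI : Integrable (fun D => ∫ θ, Real.exp (expo μ h t θ D) ∂p) P :=
    (integrable_exp_expo μ h h01 hm m (p.prod P)).integral_prod_right
  have hM : Measurable (fun D : Fin m → Z => ∫ θ, Real.exp (expo μ h t θ D) ∂p) :=
    ((measurable_expo μ h hm m).exp.stronglyMeasurable.integral_prod_left' (μ := p)).measurable
  have h1 := mul_meas_ge_le_integral_of_nonneg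
    (Filter.Eventually.of_forall fun D => integral_nonneg fun θ => (Real.exp_pos _).le) hI (1 / δ)
  have h2 := h1.trans (total_mgf μ h h01 hm ht m p)
  have h3 : P.real {D | 1 / δ ≤ ∫ θ, Real.exp (expo μ h t θ D) ∂p} ≤ δ := by
    rwa [one_div, inv_mul_le_iff₀ hδ, mul_one, ← one_div] at h2
  have hs : MeasurableSet {D : Fin m → Z | 1 / δ ≤ ∫ θ, Real.exp (expo μ h t θ D) ∂p} :=
    measurableSet_le measurable_const hM
  have h4 := probReal_compl_eq_one_sub (μ := P) hs
  calc ENNReal.ofReal (1 - δ)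
      ≤ ENNReal.ofReal (P.real {D | 1 / δ ≤ ∫ θ, Real.exp (expo μ h t θ D) ∂p}ᶜ) := by
        apply ENNReal.ofReal_le_ofReal; linarith
    _ = P {D | 1 / δ ≤ ∫ θ, Real.exp (expo μ h t θ D) ∂p}ᶜ := by simp
    _ ≤ _ := measure_mono fun D hD => by
        simp only [Set.mem_compl_iff, Set.mem_ofPred_eq, not_le] at hD ⊢
        exact hD.le

/-- Catoni PAC-Bayes bound for the zero-one loss. -/
theorem catoni_pac_bayes
    {X Y Θ : Type*} [MeasurableSpace X] [MeasurableSpace Y] [MeasurableSpace Θ]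
    (𝒟 : Measure (X × Y)) [IsProbabilityMeasure 𝒟]
    (p : Measure Θ) [IsProbabilityMeasure p]
    (f : Θ → X → Y) (l : Y → Y → ℝ)
    (hl01 : ∀ y y', l y y' = 0 ∨ l y y' = 1)
    (hmeas : Measurable (fun z : Θ × (X × Y) => l z.2.2 (f z.1 z.2.1)))
    (m : ℕ) (hm : 0 < m) (δ : ℝ) (hδ : 0 < δ)
    (β : ℝ) (hβ : 1 / 2 < β) :
    ENNReal.ofReal (1 - δ) ≤
      (Measure.pi fun _ : Fin m => 𝒟)
        {D : Fin m → X × Y | ∀ q : Measure Θ, IsProbabilityMeasure q →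
          klDiv' q p = ⊤ ∨
          (∫ θ, ∫ xy, l xy.2 (f θ xy.1) ∂𝒟 ∂q) ≤
            (1 / (1 - 1 / (2 * β))) *
              ((∫ θ, (∑ i : Fin m, l (D i).2 (f θ (D i).1)) / m ∂q) +
                (β / m) * ((klDiv' q p).toReal + Real.log (1 / δ)))} := by
  set h : Θ → X × Y → ℝ := fun θ xy => l xy.2 (f θ xy.1) with hh
  have h01 : ∀ θ z, h θ z = 0 ∨ h θ z = 1 := fun θ z => hl01 _ _
  have hm' : Measurable (fun a : Θ × (X × Y) => h a.1 a.2) := hmeas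
  have hβ0 : 0 < β := by linarith
  have ht : (0 : ℝ) ≤ 1 / β := by positivity
  refine (markov_step 𝒟 h h01 hm' ht m p δ hδ).trans (measure_mono fun D hD q hq => ?_)
  simp only [Set.mem_ofPred_eq] at hD
  by_cases hk : q ≪ p ∧ Integrable (llr q p) q
  swap
  · left; simp [klDiv', hk]
  right
  have hK : ∫ θ, llr q p θ ∂q ≤ (klDiv' q p).toReal := by
    rw [klDiv', if_pos hk, ENNReal.toReal_ofReal']
    exact le_max_left _ _
  have hgm : Measurable (fun θ => expo 𝒟 h (1 / β) θ D) :=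
    (measurable_expo 𝒟 h hm' m).comp measurable_prodMk_right
  have hg : Integrable (fun θ => expo 𝒟 h (1 / β) θ D) q :=
    Integrable.of_bound hgm.aestronglyMeasurable _
      (Filter.Eventually.of_forall fun θ => abs_expo_le 𝒟 h h01 m θ D)
  have hge : Integrable (fun θ => Real.exp (expo 𝒟 h (1 / β) θ D)) p := by
    refine Integrable.of_bound hgm.exp.aestronglyMeasurable
      (Real.exp (m * (|1 / β - (1 / β) ^ 2 / 2| + |1 / β|)))
      (Filter.Eventually.of_forall fun θ => ?_)
    rw [Real.norm_eq_abs, Real.abs_exp]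
    exact Real.exp_le_exp.2 ((le_abs_self _).trans (abs_expo_le 𝒟 h h01 m _ _))
  have hdv := dv_ineq p q _ hk.1 hk.2 hg hge
  have hlog := Real.log_le_log (integral_exp_pos hge) hD
  have hri : Integrable (fun θ => ∫ z, h θ z ∂𝒟) q :=
    Integrable.of_bound (measurable_risk 𝒟 h hm').aestronglyMeasurable 1
      (Filter.Eventually.of_forall fun θ => abs_risk_le 𝒟 h h01 θ)
  have hsi : ∀ i, Integrable (fun θ => h θ (D i)) q := fun i =>
    Integrable.of_bound (hm'.comp measurable_prodMk_right).aestronglyMeasurable 1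
      (Filter.Eventually.of_forall fun θ => by rcases h01 θ (D i) with h | h <;> simp [h])
  have hS : Integrable (fun θ => ∑ i, h θ (D i)) q := integrable_finsetSum _ fun i _ => hsi i
  have hE : ∫ θ, expo 𝒟 h (1 / β) θ D ∂q
      = m * ((1 / β - (1 / β) ^ 2 / 2) * ∫ θ, ∫ z, h θ z ∂𝒟 ∂q)
        - 1 / β * ∫ θ, ∑ i, h θ (D i) ∂q := by
    have : ∀ θ, expo 𝒟 h (1 / β) θ D = m * ((1 / β - (1 / β) ^ 2 / 2) * ∫ z, h θ z ∂𝒟)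
        - 1 / β * ∑ i, h θ (D i) := by
      intro θ
      simp [expo, Finset.sum_sub_distrib, Finset.mul_sum]
    simp_rw [this]
    rw [integral_sub ((hri.const_mul _).const_mul _) (hS.const_mul _), integral_const_mul,
      integral_const_mul, integral_const_mul]
  change (∫ θ, ∫ z, h θ z ∂𝒟 ∂q) ≤ (1 / (1 - 1 / (2 * β))) *
    ((∫ θ, (∑ i, h θ (D i)) / m ∂q) + (β / m) * ((klDiv' q p).toReal + Real.log (1 / δ)))
  rw [integral_div]
  rw [hE] at hdv
  generalize (∫ θ, ∫ z, h θ z ∂𝒟 ∂q) = L at *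
  generalize (∫ θ, ∑ i, h θ (D i) ∂q) = S at *
  generalize (klDiv' q p).toReal = K at *
  have hmr : (0 : ℝ) < m := by exact_mod_cast hm
  have hfin : m * ((1 / β - (1 / β) ^ 2 / 2) * L) - 1 / β * S ≤ K + Real.log (1 / δ) := by linarith
  generalize Real.log (1 / δ) = G at *
  have hc : 0 < 1 - 1 / (2 * β) := by
    rw [sub_pos, div_lt_one (by positivity)]; linarith
  rw [one_div_mul_eq_div, le_div_iff₀ hc]
  have h5 := mul_le_mul_of_nonneg_left hfin (show 0 ≤ β / m by positivity)
  have h6 : β / m * (m * ((1 / β - (1 / β) ^ 2 / 2) * L) - 1 / β * S)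
      = L * (1 - 1 / (2 * β)) - S / m := by
    field_simp
  linarith
end

section
/- (Property P3) Let A ∈ ℝ^{n×n}, B ∈ ℝ^{p×p}, and S ∈ ℝ^{n×p}, and define the np × np matrix Σ := (Bᵀ ⊗ A) · diag(vec(S∘S)) · (B ⊗ Aᵀ). Then Tr(Σ) = Σ_{i=1}^{n} Σ_{j=1}^{p} ( (A∘A) · (S∘S) · (B∘B) )_{ij}, where the products inside the parentheses are ordinary matrix products and ∘ denotes entrywise squaring (Hadamard product of a matrix with itself). -/
open Matrix

/-- Property P3: trace of `Σ = (Bᵀ ⊗ A) diag(vec(S∘S)) (B ⊗ Aᵀ)`. -/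
theorem property_P3 (n p : ℕ)
    (A : Matrix (Fin n) (Fin n) ℝ) (B : Matrix (Fin p) (Fin p) ℝ)
    (S : Matrix (Fin n) (Fin p) ℝ) :
    (Matrix.kroneckerMap (· * ·) Bᵀ A *
        Matrix.diagonal (fun ba : Fin p × Fin n => (S ba.2 ba.1) ^ 2) *
        Matrix.kroneckerMap (· * ·) B Aᵀ).trace =
      ∑ i : Fin n, ∑ j : Fin p,
        (Matrix.hadamard A A * Matrix.hadamard S S * Matrix.hadamard B B) i j := by
  simp only [Matrix.trace, Matrix.diag_apply]
  rw [Fintype.sum_prod_type, Finset.sum_comm]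
  refine Finset.sum_congr rfl fun i _ => Finset.sum_congr rfl fun j _ => ?_
  rw [Matrix.mul_apply, Matrix.mul_apply, Fintype.sum_prod_type]
  refine Finset.sum_congr rfl fun b _ => ?_
  rw [Matrix.mul_apply, Finset.sum_mul]
  refine Finset.sum_congr rfl fun a _ => ?_
  rw [Matrix.mul_diagonal]
  simp only [Matrix.kroneckerMap_apply, Matrix.transpose_apply, Matrix.hadamard_apply]
  ring
end

section
/- (Jacobian determinant of the Kronecker Flow) Let g_A : ℝ^n → ℝ^n and g_B : ℝ^p → ℝ^p be differentiable maps. For an n × p real matrix E, define G_A(Eᵀ) to be the p × n matrix whose j-th row is g_A applied to the j-th column of E (i.e., G_A(Eᵀ)_{j:} = g_A(E_{:j})), define G_B(F) for an n × p matrix F to be the n × p matrix whose i-th row is g_B(F_{i:}), and set G(E) := G_B(G_A(Eᵀ)ᵀ). Then G, viewed via column-stacking vectorization as a differentiable map ℝ^{np} → ℝ^{np}, has Jacobian determinant at E equal to det( ∂vec(G(E)) / ∂vec(E) ) = Π_{j=1}^{p} det( Dg_A(E_{:j}) ) · Π_{i=1}^{n} det( Dg_B( (G_A(Eᵀ)ᵀ)_{i:}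 ) ), where Dg_A and Dg_B denote the Jacobian matrices (total derivatives) of g_A and g_B. -/
theorem kf_det_cols (n p : ℕ) (f : Fin p → ((Fin n → ℝ) →ₗ[ℝ] (Fin n → ℝ)))
    (L : (Fin n → Fin p → ℝ) →ₗ[ℝ] (Fin n → Fin p → ℝ))
    (hL : ∀ v i j, L v i j = f j (fun i' => v i' j) i) :
    LinearMap.det L = ∏ j, LinearMap.det (f j) := by
  let e : (Fin n → Fin p → ℝ) ≃ₗ[ℝ] (Fin p → Fin n → ℝ) :=
    { toFun := fun v j i => v i j
      invFun := fun v i j => v j i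
      map_add' := fun _ _ => rfl
      map_smul' := fun _ _ => rfl
      left_inv := fun _ => rfl
      right_inv := fun _ => rfl }
  rw [← LinearMap.det_conj L e, ← LinearMap.det_pi]
  congr 1
  refine LinearMap.ext fun v => ?_
  funext j i
  exact hL _ i j

/-- Jacobian determinant of the Kronecker Flow. Here matrices are represented as
elements of `Fin n → Fin p → ℝ`; `G` first applies `g_A` to every column of `E` and
then applies `g_B` to every row of the result. The determinant of the Jacobian of the
vectorized map `ℝ^{np} → ℝ^{np}` (which is basis-independent, hence expressed as the
determinant of the total derivative of `G`) factorizes as the product of the Jacobian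
determinants of `g_A` at the columns of `E` and of `g_B` at the rows of the
intermediate matrix. -/
theorem kronecker_flow_jacobian_det (n p : ℕ)
    (gA : (Fin n → ℝ) → (Fin n → ℝ)) (gB : (Fin p → ℝ) → (Fin p → ℝ))
    (hA : Differentiable ℝ gA) (hB : Differentiable ℝ gB)
    (G : (Fin n → Fin p → ℝ) → (Fin n → Fin p → ℝ))
    (hG : ∀ E i j, G E i j = gB (fun j' => gA (fun i' => E i' j') i) j)
    (E : Fin n → Fin p → ℝ) :
    LinearMap.det (fderiv ℝ G E).toLinearMap =
      (∏ j : Fin p, LinearMap.det (fderiv ℝ gA (fun i => E i j)).toLinearMap) *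
        ∏ i : Fin n,
          LinearMap.det (fderiv ℝ gB (fun j => gA (fun i' => E i' j) i)).toLinearMap := by
  let A : (Fin n → Fin p → ℝ) →L[ℝ] (Fin n → Fin p → ℝ) :=
    ContinuousLinearMap.pi fun i => ContinuousLinearMap.pi fun j =>
      (ContinuousLinearMap.proj (R := ℝ) (φ := fun _ : Fin n => ℝ) i).comp
        ((fderiv ℝ gA (fun i => E i j)).comp
          (ContinuousLinearMap.pi fun i' =>
            (ContinuousLinearMap.proj (R := ℝ) (φ := fun _ : Fin p => ℝ) j).comp
              (ContinuousLinearMap.proj (R := ℝ) (φ := fun _ : Fin n => Fin p → ℝ) i')))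
  let B : (Fin n → Fin p → ℝ) →L[ℝ] (Fin n → Fin p → ℝ) :=
    ContinuousLinearMap.pi fun i =>
      (fderiv ℝ gB (fun j => gA (fun i' => E i' j) i)).comp
        (ContinuousLinearMap.proj (R := ℝ) (φ := fun _ : Fin n => Fin p → ℝ) i)
  have h1 : HasFDerivAt (fun (E : Fin n → Fin p → ℝ) i j => gA (fun i' => E i' j) i) A E := by
    refine hasFDerivAt_pi.2 fun i => hasFDerivAt_pi.2 fun j => ?_
    refine (ContinuousLinearMap.proj (R := ℝ) (φ := fun _ : Fin n => ℝ) i).hasFDerivAt.comp E ?_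
    exact HasFDerivAt.comp E (hA _).hasFDerivAt
      (ContinuousLinearMap.hasFDerivAt (ContinuousLinearMap.pi fun i' =>
            (ContinuousLinearMap.proj (R := ℝ) (φ := fun _ : Fin p => ℝ) j).comp
              (ContinuousLinearMap.proj (R := ℝ) (φ := fun _ : Fin n => Fin p → ℝ) i')))
  have h2 : HasFDerivAt (fun (F : Fin n → Fin p → ℝ) i => gB (F i)) B
      (fun i j => gA (fun i' => E i' j) i) := by
    refine hasFDerivAt_pi.2 fun i => ?_
    exact HasFDerivAt.comp (fun i j => gA (fun i' => E i' j) i) (hB _).hasFDerivAt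
      (ContinuousLinearMap.proj (R := ℝ) (φ := fun _ : Fin n => Fin p → ℝ) i).hasFDerivAt
  have h3 : HasFDerivAt G (B.comp A) E := by
    have h := HasFDerivAt.comp E h2 h1
    have hGe : G = (fun (F : Fin n → Fin p → ℝ) i => gB (F i)) ∘
        (fun (E : Fin n → Fin p → ℝ) i j => gA (fun i' => E i' j) i) := by
      funext E i j
      exact hG E i j
    rw [hGe]
    exact h
  have hAdet : LinearMap.det A.toLinearMap =
      ∏ j : Fin p, LinearMap.det (fderiv ℝ gA (fun i => E i j)).toLinearMap :=
    kf_det_cols n p (fun j => (fderiv ℝ gA (fun i => E i j)).toLinearMap) _ fun _ _ _ => rfl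
  have hBdet : LinearMap.det B.toLinearMap = ∏ i : Fin n,
      LinearMap.det (fderiv ℝ gB (fun j => gA (fun i' => E i' j) i)).toLinearMap := by
    rw [← LinearMap.det_pi]
    rfl
  rw [h3.fderiv, ← hAdet, ← hBdet, mul_comm, ← LinearMap.det_comp]
  rfl
end
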